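/- Every local derivation of the algebra W₂ is a derivation. -/

import Mathlib

set_option maxSynthPendingDepth 3

/-- The 2-dimensional vector space `V₂ = F²`, with standard basis `v₁ = (1,0)`, `v₂ = (0,1)`. -/
abbrev V2 (F : Type*) [Field F] := Fin 2 → F

/-- The fixed vector `v₁` (the first standard basis vector of `V₂`). -/
noncomputable def v1 (F : Type*) [Field F] : V2 F := Pi.single 0 1

/-- `W(2)`: the space of all bilinear multiplications on `V₂`. -/
abbrev Wtwo (F : Type*) [Field F] := V2 F →ₗ[F] V2 F →ₗ[F] V2 F

variable {F : Type*} [Field F]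

/-- The Kantor product on `W(2)`:
`(A·B)(x,y) = A(v₁, B(x,y)) − B(A(v₁,x), y) − B(x, A(v₁,y))`. -/
noncomputable def wmul (A B : Wtwo F) : Wtwo F :=
  LinearMap.mk₂ F
    (fun x y => A (v1 F) (B x y) - B (A (v1 F) x) y - B x (A (v1 F) y))
    (fun x x' y => by simp only [map_add, LinearMap.add_apply]; abel)
    (fun c x y => by simp only [map_smul, LinearMap.smul_apply, smul_sub])
    (fun x y y' => by simp only [map_add, LinearMap.add_apply]; abel)
    (fun c x y => by simp only [map_smul, LinearMap.smul_apply, smul_sub])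

/-- The multiplication `α^k_{i,j}` determined by `α^k_{i,j}(v_t, v_l) = δ_{it} δ_{jl} v_k`
(indices `0, 1` correspond to `1, 2` in the paper). -/
noncomputable def alph (k i j : Fin 2) : Wtwo F :=
  LinearMap.mk₂ F
    (fun x y => (x i * y j) • (Pi.single k 1 : V2 F))
    (fun x x' y => by simp [add_mul, add_smul])
    (fun c x y => by simp [smul_smul, mul_assoc])
    (fun x y y' => by simp [mul_add, add_smul])
    (fun c x y => by simp [smul_smul]; ring_nf)

noncomputable def e1 (F : Type*) [Field F] : Wtwo F := alph 0 0 0 - alph 1 0 1 - alph 1 1 0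

noncomputable def e2 (F : Type*) [Field F] : Wtwo F := alph 1 0 0

noncomputable def e3 (F : Type*) [Field F] : Wtwo F := alph 1 1 1 - alph 0 0 1 - alph 0 1 0

noncomputable def e4 (F : Type*) [Field F] : Wtwo F := alph 0 1 1

noncomputable def e5 (F : Type*) [Field F] : Wtwo F := (2 : F) • alph 0 0 0 + alph 1 0 1 + alph 1 1 0

noncomputable def e6 (F : Type*) [Field F] : Wtwo F := (2 : F) • alph 1 1 1 + alph 0 0 1 + alph 0 1 0


theorem wmul_add_left (A A' B : Wtwo F) : wmul (A + A') B = wmul A B + wmul A' B := by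
  apply LinearMap.ext; intro x; apply LinearMap.ext; intro y
  simp [wmul]; abel

theorem wmul_smul_left (c : F) (A B : Wtwo F) : wmul (c • A) B = c • wmul A B := by
  apply LinearMap.ext; intro x; apply LinearMap.ext; intro y
  simp [wmul, smul_sub]

theorem wmul_add_right (A B B' : Wtwo F) : wmul A (B + B') = wmul A B + wmul A B' := by
  apply LinearMap.ext; intro x; apply LinearMap.ext; intro y
  simp [wmul]; abel

theorem wmul_smul_right (c : F) (A B : Wtwo F) : wmul A (c • B) = c • wmul A B := by
  apply LinearMap.ext; intro x; apply LinearMap.ext; intro y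
  simp [wmul, smul_sub]

theorem wmul_sub_left (A A' B : Wtwo F) : wmul (A - A') B = wmul A B - wmul A' B := by
  apply LinearMap.ext; intro x; apply LinearMap.ext; intro y
  simp [wmul]; abel

theorem wmul_sub_right (A B B' : Wtwo F) : wmul A (B - B') = wmul A B - wmul A B' := by
  apply LinearMap.ext; intro x; apply LinearMap.ext; intro y
  simp [wmul]; abel

theorem wmul_alph (k i j k' i' j' : Fin 2) :
    wmul (alph k i j) (alph k' i' j' : Wtwo F) =
      (if i = 0 then (1:F) else 0) •
        ((if j = k' then (1:F) else 0) • alph k i' j'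
          - (if k = i' then (1:F) else 0) • alph k' j j'
          - (if k = j' then (1:F) else 0) • alph k' i' j) := by
  apply LinearMap.ext; intro x; apply LinearMap.ext; intro y
  funext m
  simp [wmul, alph, v1, Pi.single_apply]
  split_ifs <;> simp_all <;> try ring

theorem mul_e4_left (B : Wtwo F) : wmul (e4 F) B = 0 := by
  apply LinearMap.ext; intro x; apply LinearMap.ext; intro y
  simp [wmul, e4, alph, v1, Pi.single_apply]

theorem wmul_left_eq (A A' B : Wtwo F) (h : A (v1 F) = A' (v1 F)) : wmul A B = wmul A' B := by
  apply LinearMap.ext; intro x; apply LinearMap.ext; intro y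
  simp [wmul, h]

theorem red_e1 (B : Wtwo F) :
    wmul (e1 F) B = wmul (alph 0 0 0) B - wmul (alph 1 0 1) B := by
  rw [wmul_left_eq (e1 F) (alph 0 0 0 - alph 1 0 1) B, wmul_sub_left]
  apply LinearMap.ext; intro z; funext m
  fin_cases m <;> simp [e1, alph, v1, Pi.single_apply]

theorem red_e3 (B : Wtwo F) : wmul (e3 F) B = -wmul (alph 0 0 1) B := by
  have h : wmul (e3 F) B = wmul ((-1 : F) • alph 0 0 1) B := by
    apply wmul_left_eq
    apply LinearMap.ext; intro z; funext m
    fin_cases m <;> simp [e3, alph, v1, Pi.single_apply]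
  rw [h, wmul_smul_left]; module

theorem red_e5 (B : Wtwo F) :
    wmul (e5 F) B = (2 : F) • wmul (alph 0 0 0) B + wmul (alph 1 0 1) B := by
  rw [wmul_left_eq (e5 F) ((2 : F) • alph 0 0 0 + alph 1 0 1) B, wmul_add_left, wmul_smul_left]
  apply LinearMap.ext; intro z; funext m
  fin_cases m <;> simp [e5, alph, v1, Pi.single_apply]

theorem red_e6 (B : Wtwo F) : wmul (e6 F) B = wmul (alph 0 0 1) B := by
  apply wmul_left_eq
  apply LinearMap.ext; intro z; funext m
  fin_cases m <;> simp [e6, alph, v1, Pi.single_apply]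

theorem mul_L00_e1 : wmul (alph 0 0 0) (e1 F) = ((-1 : F)) • e1 F := by
  simp only [e1, e2, e3, e4, e5, e6, wmul_sub_right, wmul_add_right, wmul_smul_right, wmul_alph,
    Fin.reduceEq, reduceIte, one_smul, zero_smul, smul_zero, sub_zero, zero_sub,
    smul_sub, smul_add, smul_smul, neg_neg, smul_neg, neg_zero, sub_self, add_zero, zero_add]
  try module

theorem mul_L00_e2 : wmul (alph 0 0 0) (e2 F) = ((-2 : F)) • e2 F := by
  simp only [e1, e2, e3, e4, e5, e6, wmul_sub_right, wmul_add_right, wmul_smul_right, wmul_alph,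
    Fin.reduceEq, reduceIte, one_smul, zero_smul, smul_zero, sub_zero, zero_sub,
    smul_sub, smul_add, smul_smul, neg_neg, smul_neg, neg_zero, sub_self, add_zero, zero_add]
  try module

theorem mul_L00_e3 : wmul (alph 0 0 0) (e3 F) = 0 := by
  simp only [e1, e2, e3, e4, e5, e6, wmul_sub_right, wmul_add_right, wmul_smul_right, wmul_alph,
    Fin.reduceEq, reduceIte, one_smul, zero_smul, smul_zero, sub_zero, zero_sub,
    smul_sub, smul_add, smul_smul, neg_neg, smul_neg, neg_zero, sub_self, add_zero, zero_add]
  try module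

theorem mul_L00_e4 : wmul (alph 0 0 0) (e4 F) = ((1 : F)) • e4 F := by
  simp only [e1, e2, e3, e4, e5, e6, wmul_sub_right, wmul_add_right, wmul_smul_right, wmul_alph,
    Fin.reduceEq, reduceIte, one_smul, zero_smul, smul_zero, sub_zero, zero_sub,
    smul_sub, smul_add, smul_smul, neg_neg, smul_neg, neg_zero, sub_self, add_zero, zero_add]
  try module

theorem mul_L00_e5 : wmul (alph 0 0 0) (e5 F) = ((-1 : F)) • e5 F := by
  simp only [e1, e2, e3, e4, e5, e6, wmul_sub_right, wmul_add_right, wmul_smul_right, wmul_alph,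
    Fin.reduceEq, reduceIte, one_smul, zero_smul, smul_zero, sub_zero, zero_sub,
    smul_sub, smul_add, smul_smul, neg_neg, smul_neg, neg_zero, sub_self, add_zero, zero_add]
  try module

theorem mul_L00_e6 : wmul (alph 0 0 0) (e6 F) = 0 := by
  simp only [e1, e2, e3, e4, e5, e6, wmul_sub_right, wmul_add_right, wmul_smul_right, wmul_alph,
    Fin.reduceEq, reduceIte, one_smul, zero_smul, smul_zero, sub_zero, zero_sub,
    smul_sub, smul_add, smul_smul, neg_neg, smul_neg, neg_zero, sub_self, add_zero, zero_add]
  try module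

theorem mul_L01_e1 : wmul (alph 0 0 1) (e1 F) = ((2 : F)) • e3 F := by
  simp only [e1, e2, e3, e4, e5, e6, wmul_sub_right, wmul_add_right, wmul_smul_right, wmul_alph,
    Fin.reduceEq, reduceIte, one_smul, zero_smul, smul_zero, sub_zero, zero_sub,
    smul_sub, smul_add, smul_smul, neg_neg, smul_neg, neg_zero, sub_self, add_zero, zero_add]
  try module

theorem mul_L01_e2 : wmul (alph 0 0 1) (e2 F) = ((1 : F)) • e1 F := by
  simp only [e1, e2, e3, e4, e5, e6, wmul_sub_right, wmul_add_right, wmul_smul_right, wmul_alph,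
    Fin.reduceEq, reduceIte, one_smul, zero_smul, smul_zero, sub_zero, zero_sub,
    smul_sub, smul_add, smul_smul, neg_neg, smul_neg, neg_zero, sub_self, add_zero, zero_add]
  try module

theorem mul_L01_e3 : wmul (alph 0 0 1) (e3 F) = ((3 : F)) • e4 F := by
  simp only [e1, e2, e3, e4, e5, e6, wmul_sub_right, wmul_add_right, wmul_smul_right, wmul_alph,
    Fin.reduceEq, reduceIte, one_smul, zero_smul, smul_zero, sub_zero, zero_sub,
    smul_sub, smul_add, smul_smul, neg_neg, smul_neg, neg_zero, sub_self, add_zero, zero_add]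
  try module

theorem mul_L01_e4 : wmul (alph 0 0 1) (e4 F) = 0 := by
  simp only [e1, e2, e3, e4, e5, e6, wmul_sub_right, wmul_add_right, wmul_smul_right, wmul_alph,
    Fin.reduceEq, reduceIte, one_smul, zero_smul, smul_zero, sub_zero, zero_sub,
    smul_sub, smul_add, smul_smul, neg_neg, smul_neg, neg_zero, sub_self, add_zero, zero_add]
  try module

theorem mul_L01_e5 : wmul (alph 0 0 1) (e5 F) = ((-1 : F)) • e6 F := by
  simp only [e1, e2, e3, e4, e5, e6, wmul_sub_right, wmul_add_right, wmul_smul_right, wmul_alph,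
    Fin.reduceEq, reduceIte, one_smul, zero_smul, smul_zero, sub_zero, zero_sub,
    smul_sub, smul_add, smul_smul, neg_neg, smul_neg, neg_zero, sub_self, add_zero, zero_add]
  try module

theorem mul_L01_e6 : wmul (alph 0 0 1) (e6 F) = 0 := by
  simp only [e1, e2, e3, e4, e5, e6, wmul_sub_right, wmul_add_right, wmul_smul_right, wmul_alph,
    Fin.reduceEq, reduceIte, one_smul, zero_smul, smul_zero, sub_zero, zero_sub,
    smul_sub, smul_add, smul_smul, neg_neg, smul_neg, neg_zero, sub_self, add_zero, zero_add]
  try module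

theorem mul_L10_e1 : wmul (e2 F) (e1 F) = ((3 : F)) • e2 F := by
  simp only [e1, e2, e3, e4, e5, e6, wmul_sub_right, wmul_add_right, wmul_smul_right, wmul_alph,
    Fin.reduceEq, reduceIte, one_smul, zero_smul, smul_zero, sub_zero, zero_sub,
    smul_sub, smul_add, smul_smul, neg_neg, smul_neg, neg_zero, sub_self, add_zero, zero_add]
  try module

theorem mul_L10_e2 : wmul (e2 F) (e2 F) = 0 := by
  simp only [e1, e2, e3, e4, e5, e6, wmul_sub_right, wmul_add_right, wmul_smul_right, wmul_alph,
    Fin.reduceEq, reduceIte, one_smul, zero_smul, smul_zero, sub_zero, zero_sub,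
    smul_sub, smul_add, smul_smul, neg_neg, smul_neg, neg_zero, sub_self, add_zero, zero_add]
  try module

theorem mul_L10_e3 : wmul (e2 F) (e3 F) = ((2 : F)) • e1 F := by
  simp only [e1, e2, e3, e4, e5, e6, wmul_sub_right, wmul_add_right, wmul_smul_right, wmul_alph,
    Fin.reduceEq, reduceIte, one_smul, zero_smul, smul_zero, sub_zero, zero_sub,
    smul_sub, smul_add, smul_smul, neg_neg, smul_neg, neg_zero, sub_self, add_zero, zero_add]
  try module

theorem mul_L10_e4 : wmul (e2 F) (e4 F) = ((1 : F)) • e3 F := by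
  simp only [e1, e2, e3, e4, e5, e6, wmul_sub_right, wmul_add_right, wmul_smul_right, wmul_alph,
    Fin.reduceEq, reduceIte, one_smul, zero_smul, smul_zero, sub_zero, zero_sub,
    smul_sub, smul_add, smul_smul, neg_neg, smul_neg, neg_zero, sub_self, add_zero, zero_add]
  try module

theorem mul_L10_e5 : wmul (e2 F) (e5 F) = 0 := by
  simp only [e1, e2, e3, e4, e5, e6, wmul_sub_right, wmul_add_right, wmul_smul_right, wmul_alph,
    Fin.reduceEq, reduceIte, one_smul, zero_smul, smul_zero, sub_zero, zero_sub,
    smul_sub, smul_add, smul_smul, neg_neg, smul_neg, neg_zero, sub_self, add_zero, zero_add]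
  try module

theorem mul_L10_e6 : wmul (e2 F) (e6 F) = ((-1 : F)) • e5 F := by
  simp only [e1, e2, e3, e4, e5, e6, wmul_sub_right, wmul_add_right, wmul_smul_right, wmul_alph,
    Fin.reduceEq, reduceIte, one_smul, zero_smul, smul_zero, sub_zero, zero_sub,
    smul_sub, smul_add, smul_smul, neg_neg, smul_neg, neg_zero, sub_self, add_zero, zero_add]
  try module

theorem mul_L11_e1 : wmul (alph 1 0 1) (e1 F) = 0 := by
  simp only [e1, e2, e3, e4, e5, e6, wmul_sub_right, wmul_add_right, wmul_smul_right, wmul_alph,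
    Fin.reduceEq, reduceIte, one_smul, zero_smul, smul_zero, sub_zero, zero_sub,
    smul_sub, smul_add, smul_smul, neg_neg, smul_neg, neg_zero, sub_self, add_zero, zero_add]
  try module

theorem mul_L11_e2 : wmul (alph 1 0 1) (e2 F) = ((1 : F)) • e2 F := by
  simp only [e1, e2, e3, e4, e5, e6, wmul_sub_right, wmul_add_right, wmul_smul_right, wmul_alph,
    Fin.reduceEq, reduceIte, one_smul, zero_smul, smul_zero, sub_zero, zero_sub,
    smul_sub, smul_add, smul_smul, neg_neg, smul_neg, neg_zero, sub_self, add_zero, zero_add]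
  try module

theorem mul_L11_e3 : wmul (alph 1 0 1) (e3 F) = ((-1 : F)) • e3 F := by
  simp only [e1, e2, e3, e4, e5, e6, wmul_sub_right, wmul_add_right, wmul_smul_right, wmul_alph,
    Fin.reduceEq, reduceIte, one_smul, zero_smul, smul_zero, sub_zero, zero_sub,
    smul_sub, smul_add, smul_smul, neg_neg, smul_neg, neg_zero, sub_self, add_zero, zero_add]
  try module

theorem mul_L11_e4 : wmul (alph 1 0 1) (e4 F) = ((-2 : F)) • e4 F := by
  simp only [e1, e2, e3, e4, e5, e6, wmul_sub_right, wmul_add_right, wmul_smul_right, wmul_alph,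
    Fin.reduceEq, reduceIte, one_smul, zero_smul, smul_zero, sub_zero, zero_sub,
    smul_sub, smul_add, smul_smul, neg_neg, smul_neg, neg_zero, sub_self, add_zero, zero_add]
  try module

theorem mul_L11_e5 : wmul (alph 1 0 1) (e5 F) = 0 := by
  simp only [e1, e2, e3, e4, e5, e6, wmul_sub_right, wmul_add_right, wmul_smul_right, wmul_alph,
    Fin.reduceEq, reduceIte, one_smul, zero_smul, smul_zero, sub_zero, zero_sub,
    smul_sub, smul_add, smul_smul, neg_neg, smul_neg, neg_zero, sub_self, add_zero, zero_add]
  try module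

theorem mul_L11_e6 : wmul (alph 1 0 1) (e6 F) = ((-1 : F)) • e6 F := by
  simp only [e1, e2, e3, e4, e5, e6, wmul_sub_right, wmul_add_right, wmul_smul_right, wmul_alph,
    Fin.reduceEq, reduceIte, one_smul, zero_smul, smul_zero, sub_zero, zero_sub,
    smul_sub, smul_add, smul_smul, neg_neg, smul_neg, neg_zero, sub_self, add_zero, zero_add]
  try module

/-- `W2` as a subspace of `W(2)`. -/
noncomputable def W2 (F : Type*) [Field F] : Submodule F (Wtwo F) :=
  Submodule.span F {e1 F, e2 F, e3 F, e4 F, e5 F, e6 F}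

/-- The Kantor product, as a bilinear map. -/
noncomputable def wmulL (F : Type*) [Field F] : Wtwo F →ₗ[F] Wtwo F →ₗ[F] Wtwo F :=
  LinearMap.mk₂ F wmul wmul_add_left wmul_smul_left wmul_add_right wmul_smul_right

set_option maxHeartbeats 2000000 in
theorem W2_mul_mem {x y : Wtwo F} (hx : x ∈ W2 F) (hy : y ∈ W2 F) :
    wmul x y ∈ W2 F := by
  have h2 : Submodule.map₂ (wmulL F) (W2 F) (W2 F) ≤ W2 F := by
    rw [W2, Submodule.map₂_span_span, Submodule.span_le]
    rintro z ⟨a, ha, b, hb, rfl⟩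
    simp only [Set.mem_insert_iff, Set.mem_singleton_iff] at ha hb
    have m1 : e1 F ∈ W2 F := Submodule.subset_span (by simp)
    have m2 : e2 F ∈ W2 F := Submodule.subset_span (by simp)
    have m3 : e3 F ∈ W2 F := Submodule.subset_span (by simp)
    have m4 : e4 F ∈ W2 F := Submodule.subset_span (by simp)
    have m5 : e5 F ∈ W2 F := Submodule.subset_span (by simp)
    have m6 : e6 F ∈ W2 F := Submodule.subset_span (by simp)
    rcases ha with rfl | rfl | rfl | rfl | rfl | rfl <;> rcases hb with rfl | rfl | rfl | rfl | rfl | rfl <;>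
      simp only [wmulL, LinearMap.mk₂_apply, red_e1, red_e3, red_e5, red_e6, mul_L00_e1, mul_L00_e2, mul_L00_e3, mul_L00_e4, mul_L00_e5, mul_L00_e6, mul_L01_e1, mul_L01_e2, mul_L01_e3, mul_L01_e4, mul_L01_e5, mul_L01_e6, mul_L10_e1, mul_L10_e2, mul_L10_e3, mul_L10_e4, mul_L10_e5, mul_L10_e6, mul_L11_e1, mul_L11_e2, mul_L11_e3, mul_L11_e4, mul_L11_e5, mul_L11_e6, mul_e4_left,
        smul_smul, smul_zero, neg_zero, sub_zero, zero_sub, zero_add, add_zero, smul_neg,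
        neg_neg, sub_self] <;>
      (repeat' first
        | exact Submodule.zero_mem _
        | exact m1 | exact m2 | exact m3 | exact m4 | exact m5 | exact m6
        | apply Submodule.neg_mem
        | apply Submodule.sub_mem
        | apply Submodule.add_mem
        | apply Submodule.smul_mem)
  exact h2 (Submodule.apply_mem_map₂ _ hx hy)

/-- The product on `W2` (the Kantor product, which leaves `W2` invariant). -/
noncomputable def W2mul (x y : W2 F) : W2 F :=
  ⟨wmul x y, W2_mul_mem x.2 y.2⟩

/-- A derivation of the algebra `W2`. -/
def IsDerivationW2 (D : W2 F →ₗ[F] W2 F) : Prop :=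
  ∀ x y : W2 F, D (W2mul x y) = W2mul (D x) y + W2mul x (D y)

/-- The element of `W2` with coordinates `a₁, …, a₆` in the basis `e₁, …, e₆`. -/
noncomputable def comb (a₁ a₂ a₃ a₄ a₅ a₆ : F) : W2 F :=
  ⟨a₁ • e1 F + a₂ • e2 F + a₃ • e3 F + a₄ • e4 F + a₅ • e5 F + a₆ • e6 F, by
    have h : ∀ z ∈ ({e1 F, e2 F, e3 F, e4 F, e5 F, e6 F} : Set (Wtwo F)), ∀ a : F,
        a • z ∈ W2 F := fun z hz a => Submodule.smul_mem _ a (Submodule.subset_span hz)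
    refine add_mem (add_mem (add_mem (add_mem (add_mem ?_ ?_) ?_) ?_) ?_) ?_ <;>
      exact h _ (by simp) _⟩

theorem comb_apply (a₁ a₂ a₃ a₄ a₅ a₆ : F) (x y : V2 F) :
    (comb a₁ a₂ a₃ a₄ a₅ a₆ : Wtwo F) x y =
      ![(a₁ + 2 * a₅) * (x 0 * y 0) + (a₆ - a₃) * (x 0 * y 1 + x 1 * y 0) + a₄ * (x 1 * y 1),
        a₂ * (x 0 * y 0) + (a₅ - a₁) * (x 0 * y 1 + x 1 * y 0) + (a₃ + 2 * a₆) * (x 1 * y 1)] := by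
  funext m
  fin_cases m <;>
  · simp [comb, e1, e2, e3, e4, e5, e6, alph]
    ring

theorem exists_eq_comb (x : W2 F) :
    ∃ a₁ a₂ a₃ a₄ a₅ a₆ : F, x = comb a₁ a₂ a₃ a₄ a₅ a₆ := by
  obtain ⟨x, hx⟩ := x
  have hx' := hx
  simp only [W2, Submodule.mem_span_insert, Submodule.mem_span_singleton] at hx'
  obtain ⟨a₁, _, ⟨a₂, _, ⟨a₃, _, ⟨a₄, _, ⟨a₅, _, ⟨a₆, rfl⟩, rfl⟩, rfl⟩, rfl⟩, rfl⟩, rfl⟩ := hx'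
  refine ⟨a₁, a₂, a₃, a₄, a₅, a₆, Subtype.ext ?_⟩
  simp only [comb]
  abel

theorem comb_inj [CharZero F] {a₁ a₂ a₃ a₄ a₅ a₆ b₁ b₂ b₃ b₄ b₅ b₆ : F} :
    comb a₁ a₂ a₃ a₄ a₅ a₆ = comb b₁ b₂ b₃ b₄ b₅ b₆ ↔
      a₁ = b₁ ∧ a₂ = b₂ ∧ a₃ = b₃ ∧ a₄ = b₄ ∧ a₅ = b₅ ∧ a₆ = b₆ := by
  refine ⟨fun h => ?_, by rintro ⟨rfl, rfl, rfl, rfl, rfl, rfl⟩; rfl⟩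
  have key (i j k : Fin 2) := congrArg
    (fun z : W2 F => (z : Wtwo F) (Pi.single i 1) (Pi.single j 1) k) h
  have h₁ := key 0 0 0
  have h₂ := key 0 0 1
  have h₃ := key 0 1 0
  have h₄ := key 0 1 1
  have h₅ := key 1 1 0
  have h₆ := key 1 1 1
  simp [comb, e1, e2, e3, e4, e5, e6, alph] at h₁ h₂ h₃ h₄ h₅ h₆
  have three : (3 : F) ≠ 0 := by norm_num
  refine ⟨?_, h₂, ?_, h₅, ?_, ?_⟩ <;> apply mul_left_cancel₀ three
  · linear_combination h₁ - 2 * h₄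
  · linear_combination h₆ - 2 * h₃
  · linear_combination h₁ + h₄
  · linear_combination h₆ + h₃

theorem comb_add (a₁ a₂ a₃ a₄ a₅ a₆ b₁ b₂ b₃ b₄ b₅ b₆ : F) :
    comb a₁ a₂ a₃ a₄ a₅ a₆ + comb b₁ b₂ b₃ b₄ b₅ b₆ =
      comb (a₁ + b₁) (a₂ + b₂) (a₃ + b₃) (a₄ + b₄) (a₅ + b₅) (a₆ + b₆) := by
  apply Subtype.ext
  simp only [comb, Submodule.coe_add]
  module

theorem smul_comb (c a₁ a₂ a₃ a₄ a₅ a₆ : F) :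
    c • comb a₁ a₂ a₃ a₄ a₅ a₆ =
      comb (c * a₁) (c * a₂) (c * a₃) (c * a₄) (c * a₅) (c * a₆) := by
  apply Subtype.ext
  simp only [comb, Submodule.coe_smul]
  module

theorem W2mul_comb (a₁ a₂ a₃ a₄ a₅ a₆ b₁ b₂ b₃ b₄ b₅ b₆ : F) :
    W2mul (comb a₁ a₂ a₃ a₄ a₅ a₆) (comb b₁ b₂ b₃ b₄ b₅ b₆) =
      comb (-(a₁ + 2 * a₅) * b₁ + (a₆ - a₃) * b₂ + 2 * a₂ * b₃)
        (3 * a₂ * b₁ - 3 * (a₁ + a₅) * b₂)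
        (2 * (a₆ - a₃) * b₁ + (a₁ - a₅) * b₃ + a₂ * b₄)
        (3 * (a₆ - a₃) * b₃ + 3 * a₁ * b₄)
        (-(a₁ + 2 * a₅) * b₅ - a₂ * b₆)
        (-(a₆ - a₃) * b₅ + (a₁ - a₅) * b₆) := by
  apply Subtype.ext
  apply LinearMap.ext; intro x; apply LinearMap.ext; intro y
  simp only [W2mul, wmul, LinearMap.mk₂_apply, comb_apply]
  funext m
  fin_cases m <;>
  · simp [v1]
    ring

theorem map_comb (D : W2 F →ₗ[F] W2 F) (a₁ a₂ a₃ a₄ a₅ a₆ : F) :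
    D (comb a₁ a₂ a₃ a₄ a₅ a₆) =
      a₁ • D (comb 1 0 0 0 0 0) + a₂ • D (comb 0 1 0 0 0 0) + a₃ • D (comb 0 0 1 0 0 0) +
      a₄ • D (comb 0 0 0 1 0 0) + a₅ • D (comb 0 0 0 0 1 0) + a₆ • D (comb 0 0 0 0 0 1) := by
  simp only [← map_smul, ← map_add, smul_comb, comb_add, mul_one, mul_zero, add_zero, zero_add]

/-- Every derivation of `W2` is a combination of left multiplication by `e₆` and by
`(e₅ - 2 e₁) / 3`. -/
theorem IsDerivationW2.exists_apply_comb [CharZero F] {D : W2 F →ₗ[F] W2 F}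
    (hD : IsDerivationW2 D) :
    ∃ α β : F, ∀ a₁ a₂ a₃ a₄ a₅ a₆ : F, D (comb a₁ a₂ a₃ a₄ a₅ a₆) =
      comb (α * a₂) (β * a₂) (2 * α * a₁ - β * a₃) (3 * α * a₃ - 2 * β * a₄) 0
        (-α * a₅ - β * a₆) := by
  obtain ⟨p₁, p₂, p₃, p₄, p₅, p₆, hp⟩ := exists_eq_comb (D (comb 1 0 0 0 0 0))
  obtain ⟨q₁, q₂, q₃, q₄, q₅, q₆, hq⟩ := exists_eq_comb (D (comb 0 1 0 0 0 0))
  obtain ⟨r₁, r₂, r₃, r₄, r₅, r₆, hr⟩ := exists_eq_comb (D (comb 0 0 1 0 0 0))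
  obtain ⟨s₁, s₂, s₃, s₄, s₅, s₆, hs⟩ := exists_eq_comb (D (comb 0 0 0 1 0 0))
  obtain ⟨t₁, t₂, t₃, t₄, t₅, t₆, ht⟩ := exists_eq_comb (D (comb 0 0 0 0 1 0))
  obtain ⟨u₁, u₂, u₃, u₄, u₅, u₆, hu⟩ := exists_eq_comb (D (comb 0 0 0 0 0 1))
  have h41 := hD (comb 0 0 0 1 0 0) (comb 1 0 0 0 0 0)
  have h42 := hD (comb 0 0 0 1 0 0) (comb 0 1 0 0 0 0)
  have h44 := hD (comb 0 0 0 1 0 0) (comb 0 0 0 1 0 0)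
  have h14 := hD (comb 1 0 0 0 0 0) (comb 0 0 0 1 0 0)
  have h11 := hD (comb 1 0 0 0 0 0) (comb 1 0 0 0 0 0)
  have h24 := hD (comb 0 1 0 0 0 0) (comb 0 0 0 1 0 0)
  have h12 := hD (comb 1 0 0 0 0 0) (comb 0 1 0 0 0 0)
  have h33 := hD (comb 0 0 1 0 0 0) (comb 0 0 1 0 0 0)
  have h15 := hD (comb 1 0 0 0 0 0) (comb 0 0 0 0 1 0)
  have h54 := hD (comb 0 0 0 0 1 0) (comb 0 0 0 1 0 0)
  have h55 := hD (comb 0 0 0 0 1 0) (comb 0 0 0 0 1 0)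
  have h35 := hD (comb 0 0 1 0 0 0) (comb 0 0 0 0 1 0)
  have hcomb (a₁ a₂ a₃ a₄ a₅ a₆ : F) := map_comb D a₁ a₂ a₃ a₄ a₅ a₆
  simp only [hp, hq, hr, hs, ht, hu, smul_comb, comb_add] at hcomb
  clear hp hq hr hs ht hu
  simp only [W2mul_comb, hcomb, comb_add, comb_inj, mul_zero, mul_one, zero_mul, add_zero,
    zero_add, sub_zero, zero_sub, neg_zero, sub_self]
    at h41 h42 h44 h14 h11 h24 h12 h33 h15 h54 h55 h35
  refine ⟨q₁, q₂, fun a₁ a₂ a₃ a₄ a₅ a₆ => ?_⟩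
  rw [hcomb, comb_inj]
  grind

/-- Every local derivation of the algebra `W2` is a derivation. -/
theorem every_localDerivation_isDerivation_W2 {F : Type*} [Field F] [CharZero F]
    (T : W2 F →ₗ[F] W2 F)
    (hT : ∀ x : W2 F, ∃ D : W2 F →ₗ[F] W2 F, IsDerivationW2 D ∧ T x = D x) :
    IsDerivationW2 T := by
  obtain ⟨D, hD, hTD⟩ := hT (comb 0 1 0 0 0 0)
  obtain ⟨α, β, hαβ⟩ := hD.exists_apply_comb
  rw [hαβ] at hTD
  have agree {a₁ a₃ a₄ a₅ a₆ : F} :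
      T (comb a₁ 0 a₃ a₄ a₅ a₆) = D (comb a₁ 0 a₃ a₄ a₅ a₆) := by
    obtain ⟨D', hD', hT'⟩ := hT (comb a₁ 0 a₃ a₄ a₅ a₆)
    obtain ⟨D'', hD'', hT''⟩ := hT (comb a₁ 1 a₃ a₄ a₅ a₆)
    obtain ⟨γ, δ, hγδ⟩ := hD'.exists_apply_comb
    obtain ⟨ε, ζ, hεζ⟩ := hD''.exists_apply_comb
    have hsum : comb a₁ 1 a₃ a₄ a₅ a₆ = comb 0 1 0 0 0 0 + comb a₁ 0 a₃ a₄ a₅ a₆ := by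
      simp only [comb_add, zero_add, add_zero]
    rw [hεζ, hsum, map_add, hTD, hT', hγδ, comb_add, comb_inj] at hT''
    rw [hT', hγδ, hαβ, comb_inj]
    grind
  have hTeq : T = D := by
    ext1 x
    obtain ⟨a₁, a₂, a₃, a₄, a₅, a₆, rfl⟩ := exists_eq_comb x
    rw [map_comb T, map_comb D, hTD, hαβ 0 1 0 0 0 0]
    simp only [agree]
  exact hTeq ▸ hD
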